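/- Let G be a finite simple connected block graph (every block of G is a complete graph) with exactly ℓ blocks. Then the rank of G with respect to Δ-convexity satisfies d_Δ(G) = ℓ + 1. -/

import Mathlib

variable {V : Type*}

/-- A set `S` is Δ-convex in `G` if every vertex adjacent to two adjacent vertices of `S`
belongs to `S`. -/
def DeltaConvex (G : SimpleGraph V) (S : Set V) : Prop :=
  ∀ ⦃u v w : V⦄, u ∈ S → v ∈ S → G.Adj u v → G.Adj w u → G.Adj w v → w ∈ S

/-- The Δ-convex hull of `S`: the smallest Δ-convex set containing `S`. -/
def deltaHull (G : SimpleGraph V) (S : Set V) : Set V :=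
  ⋂₀ {T : Set V | S ⊆ T ∧ DeltaConvex G T}

/-- `S` is Helly independent: the intersection of the hulls of the sets `S \ {a}`, `a ∈ S`,
is empty. -/
def HellyIndep (G : SimpleGraph V) (S : Set V) : Prop :=
  (⋂ a ∈ S, deltaHull G (S \ {a})) = ∅

/-- The Helly number of `G` w.r.t. Δ-convexity: the maximum cardinality of a Helly
independent subset of the vertex set. -/
noncomputable def hellyNumber (G : SimpleGraph V) : ℕ :=
  sSup {n : ℕ | ∃ S : Set V, HellyIndep G S ∧ S.ncard = n}

/-- `S` is Radon independent: no partition of `S` into two nonempty disjoint parts has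
intersecting hulls. -/
def RadonIndep (G : SimpleGraph V) (S : Set V) : Prop :=
  ¬ ∃ S₁ S₂ : Set V, S₁ ∪ S₂ = S ∧ Disjoint S₁ S₂ ∧ S₁.Nonempty ∧ S₂.Nonempty ∧
    (deltaHull G S₁ ∩ deltaHull G S₂).Nonempty

/-- The Radon number of `G` w.r.t. Δ-convexity. -/
noncomputable def radonNumber (G : SimpleGraph V) : ℕ :=
  sSup {n : ℕ | ∃ S : Set V, RadonIndep G S ∧ S.ncard = n}

/-- `S` is convexly independent: `a ∉ ⟨S \ {a}⟩` for every `a ∈ S`. -/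
def ConvIndep (G : SimpleGraph V) (S : Set V) : Prop :=
  ∀ a ∈ S, a ∉ deltaHull G (S \ {a})

/-- The rank of `G` w.r.t. Δ-convexity. -/
noncomputable def rankDelta (G : SimpleGraph V) : ℕ :=
  sSup {n : ℕ | ∃ S : Set V, ConvIndep G S ∧ S.ncard = n}

/-- The independence number: maximum cardinality of a set of pairwise non-adjacent
vertices. -/
noncomputable def alphaNum (G : SimpleGraph V) : ℕ :=
  sSup {n : ℕ | ∃ S : Set V, S.Pairwise (fun a b => ¬ G.Adj a b) ∧ S.ncard = n}

/-- `G` is 2-connected: at least 3 vertices, connected, and deleting any single vertex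
leaves a connected graph. -/
def TwoConnected (G : SimpleGraph V) : Prop :=
  3 ≤ Nat.card V ∧ G.Connected ∧ ∀ v : V, (G.induce {u : V | u ≠ v}).Connected

/-- `G` is chordal: every cycle of length at least 4 has a chord, i.e. an edge of `G`
joining two vertices of the cycle that is not an edge of the cycle. -/
def ChordalGraph (G : SimpleGraph V) : Prop :=
  ∀ (v : V) (c : G.Walk v v), c.IsCycle → 4 ≤ c.length →
    ∃ x y : V, x ∈ c.support ∧ y ∈ c.support ∧ G.Adj x y ∧ s(x, y) ∉ c.edges

/-- `B` induces a connected subgraph of `G` with at least two vertices and no cut vertex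
(so: an edge, or a 2-connected subgraph). -/
def NoCutSet (G : SimpleGraph V) (B : Set V) : Prop :=
  2 ≤ B.ncard ∧ (G.induce B).Connected ∧ ∀ v ∈ B, (G.induce (B \ {v})).Connected

/-- `B` is (the vertex set of) a block of `G`: a maximal 2-connected subgraph, where a
bridge together with its endpoints also counts as a block. -/
def IsBlock (G : SimpleGraph V) (B : Set V) : Prop :=
  NoCutSet G B ∧ ∀ B' : Set V, NoCutSet G B' → B ⊆ B' → B = B'

/-- The set `B` induces a complete subgraph of `G`. -/
def CompleteOn (G : SimpleGraph V) (B : Set V) : Prop :=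
  ∀ u ∈ B, ∀ v ∈ B, u ≠ v → G.Adj u v

/-- A set is closed for a family of lines if it contains every line meeting it in two points. -/
def LineClosed (L : Set (Set V)) (T : Set V) : Prop :=
  ∀ B ∈ L, ∀ u ∈ B, ∀ v ∈ B, u ≠ v → u ∈ T → v ∈ T → B ⊆ T

/-- Convex independence for the convexity of line-closed sets. -/
def LineIndep (L : Set (Set V)) (S : Set V) : Prop :=
  ∀ a ∈ S, ∃ T, S \ {a} ⊆ T ∧ LineClosed L T ∧ a ∉ T

/-- `Hypertree L U` says that the hypergraph on `U` with edge set `L` arises from a single vertex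
by successively attaching edges, each meeting the previous ones in exactly one vertex. -/
inductive Hypertree : Set (Set V) → Set V → Prop
  | singleton (r : V) : Hypertree ∅ {r}
  | attach {L : Set (Set V)} {U B : Set V} {c b : V} (h : Hypertree L U) (hB : B ∩ U = {c})
      (hb : b ∈ B) (hbU : b ∉ U) : Hypertree (insert B L) (U ∪ B)

theorem LineClosed.mono {L L' : Set (Set V)} {T : Set V} (h : LineClosed L' T) (hL : L ⊆ L') :
    LineClosed L T :=
  fun B hB => h B (hL hB)

theorem LineIndep.mono {L L' : Set (Set V)} {S : Set V} (h : LineIndep L' S) (hL : L ⊆ L') :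
    LineIndep L S := fun a ha =>
  let ⟨T, h1, h2, h3⟩ := h a ha
  ⟨T, h1, h2.mono hL, h3⟩

theorem LineIndep.subset {L : Set (Set V)} {S S' : Set V} (h : LineIndep L S) (hS : S' ⊆ S) :
    LineIndep L S' := fun a ha =>
  let ⟨T, h1, h2, h3⟩ := h a (hS ha)
  ⟨T, (Set.sdiff_subset_sdiff_left hS).trans h1, h2, h3⟩

theorem Hypertree.subset {L : Set (Set V)} {U : Set V} (h : Hypertree L U) :
    ∀ B ∈ L, B ⊆ U := by
  induction h with
  | singleton r => simp
  | attach h hB hb hbU ih =>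
    rintro D (rfl | hD)
    · exact Set.subset_union_right
    · exact (ih D hD).trans Set.subset_union_left

theorem LineIndep.eq_of_mem_line {L : Set (Set V)} {S B : Set V} {x y z : V}
    (h : LineIndep L S) (hB : B ∈ L) (hx : x ∈ S ∩ B) (hy : y ∈ S ∩ B) (hz : z ∈ S ∩ B)
    (hxy : x ≠ y) (hxz : x ≠ z) : y = z := by
  by_contra hyz
  obtain ⟨T, h1, h2, h3⟩ := h x hx.1
  exact h3 (h2 B hB y hy.2 z hz.2 hyz (h1 ⟨hy.1, hxy.symm⟩) (h1 ⟨hz.1, hxz.symm⟩) hx.2)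

/-- Two points of a line in an independent set may be traded for a third point of that line. -/
theorem LineIndep.exchange {L : Set (Set V)} {S B : Set V} {x y c : V}
    (h : LineIndep L S) (hB : B ∈ L) (hx : x ∈ S ∩ B) (hy : y ∈ S ∩ B) (hxy : x ≠ y)
    (hc : c ∈ B) (hcS : c ∉ S) : LineIndep L (insert c (S \ {x, y})) := by
  have hcy : c ≠ y := fun e => hcS (e ▸ hy.1)
  rintro a (rfl | ⟨haS, ha⟩)
  · obtain ⟨T, h1, h2, h3⟩ := h x hx.1
    refine ⟨T, ?_, h2, fun hcT => h3 ?_⟩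
    · rintro z ⟨rfl | ⟨hz, hz'⟩, hza⟩
      · exact absurd rfl hza
      · exact h1 ⟨hz, fun e => hz' (Or.inl e)⟩
    · exact h2 B hB _ hc y hy.2 hcy hcT (h1 ⟨hy.1, hxy.symm⟩) hx.2
  · obtain ⟨T, h1, h2, h3⟩ := h a haS
    refine ⟨T, ?_, h2, h3⟩
    have hax : x ≠ a := fun e => ha (Or.inl e.symm)
    have hay : y ≠ a := fun e => ha (Or.inr e.symm)
    rintro z ⟨rfl | ⟨hz, -⟩, hza⟩
    · exact h2 B hB x hx.2 y hy.2 hxy (h1 ⟨hx.1, hax⟩) (h1 ⟨hy.1, hay⟩) hc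
    · exact h1 ⟨hz, hza⟩

theorem Hypertree.ncard_le [Finite V] {L : Set (Set V)} {U : Set V} (h : Hypertree L U) :
    ∀ S ⊆ U, LineIndep L S → S.ncard ≤ L.ncard + 1 := by
  induction h with
  | singleton r =>
    intro S hS _
    simpa using Set.ncard_le_ncard hS
  | @attach L U B c b h hB hb hbU ih =>
    intro S hS hI
    have hBL : B ∉ L := fun hB' => hbU (h.subset B hB' hb)
    rw [Set.ncard_insert_of_notMem hBL]
    have hc : c ∈ B ∩ U := hB ▸ rfl
    have hL : L ⊆ insert B L := Set.subset_insert B L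
    rcases (S \ U).eq_empty_or_nonempty with he | ⟨x, hxS, hxU⟩
    · exact (ih S (Set.sdiff_eq_empty.1 he) (hI.mono hL)).trans (by omega)
    have hxB : x ∈ B := (hS hxS).resolve_left hxU
    by_cases hy : ∃ y ∈ S \ U, y ≠ x
    · obtain ⟨y, ⟨hyS, hyU⟩, hyx⟩ := hy
      have hyB : y ∈ B := (hS hyS).resolve_left hyU
      have hxc : x ≠ c := fun e => hxU (e ▸ hc.2)
      have hyc : y ≠ c := fun e => hyU (e ▸ hc.2)
      have hcS : c ∉ S := fun hcS => hyc
        (hI.eq_of_mem_line (Set.mem_insert B L) ⟨hxS, hxB⟩ ⟨hyS, hyB⟩ ⟨hcS, hc.1⟩ hyx.symm hxc)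
      have hI' := hI.exchange (Set.mem_insert B L) ⟨hxS, hxB⟩ ⟨hyS, hyB⟩ hyx.symm hc.1 hcS
      have hle := ih _ (by
        rintro z (rfl | ⟨hzS, hz⟩)
        · exact hc.2
        · by_contra hzU
          have hzB : z ∈ B := (hS hzS).resolve_left hzU
          refine hz (or_iff_not_imp_left.2 fun hzx => ?_)
          exact (hI.eq_of_mem_line (Set.mem_insert B L) ⟨hxS, hxB⟩ ⟨hyS, hyB⟩ ⟨hzS, hzB⟩
            hyx.symm (Ne.symm hzx)).symm) (hI'.mono hL)
      rw [Set.ncard_insert_of_notMem (fun hh => hcS hh.1)] at hle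
      have h2 : ({x, y} : Set V).ncard = 2 := Set.ncard_pair hyx.symm
      have h3 : (S \ {x, y}).ncard + ({x, y} : Set V).ncard = S.ncard :=
        Set.ncard_sdiff_add_ncard_of_subset (Set.insert_subset hxS (Set.singleton_subset_iff.2 hyS))
      omega
    · push Not at hy
      have hle := ih (S \ {x}) (fun z hz => by
        by_contra hzU
        exact hz.2 (hy z ⟨hz.1, hzU⟩)) ((hI.mono hL).subset Set.sdiff_subset)
      have := Set.ncard_sdiff_singleton_add_one hxS
      omega

theorem Hypertree.exists_lineIndep [Finite V] {L : Set (Set V)} {U : Set V} (h : Hypertree L U) :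
    ∃ S ⊆ U, LineIndep L S ∧ S.ncard = L.ncard + 1 := by
  induction h with
  | singleton r =>
    refine ⟨{r}, subset_rfl, ?_, by simp⟩
    rintro a rfl
    exact ⟨∅, by simp, fun B hB => absurd hB (Set.notMem_empty B), by simp⟩
  | @attach L U B c b h hB hb hbU ih =>
    obtain ⟨S, hSU, hI, hcard⟩ := ih
    have hBL : B ∉ L := fun hB' => hbU (h.subset B hB' hb)
    have hbS : b ∉ S := fun hbS => hbU (hSU hbS)
    have hBU : ∀ z ∈ B, z ∈ U → z = c := fun z h1 h2 => by
      have : z ∈ B ∩ U := ⟨h1, h2⟩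
      rwa [hB] at this
    have hcB : c ∈ B ∩ U := hB ▸ rfl
    refine ⟨insert b S, Set.insert_subset (Or.inr hb) (hSU.trans Set.subset_union_left), ?_, ?_⟩
    swap
    · rw [Set.ncard_insert_of_notMem hBL, Set.ncard_insert_of_notMem hbS, hcard]
    rintro a (rfl | ha)
    · refine ⟨U, ?_, ?_, hbU⟩
      · rintro z ⟨rfl | hz, hza⟩
        · exact absurd rfl hza
        · exact hSU hz
      · rintro D (rfl | hD) u hu v hv huv huU hvU
        · exact absurd ((hBU u hu huU).trans (hBU v hv hvU).symm) huv
        · exact h.subset D hD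
    · obtain ⟨T, h1, h2, h3⟩ := hI a ha
      have haU := hSU ha
      by_cases hcT : c ∈ T
      · refine ⟨(T ∩ U) ∪ B, ?_, ?_, ?_⟩
        · rintro z ⟨rfl | hz, hza⟩
          · exact Or.inr hb
          · exact Or.inl ⟨h1 ⟨hz, hza⟩, hSU hz⟩
        · rintro D (rfl | hD) u hu v hv huv huT hvT
          · exact Set.subset_union_right
          · have key : ∀ z ∈ D, z ∈ (T ∩ U) ∪ B → z ∈ T := by
              rintro z hz (hz' | hz')
              · exact hz'.1
              · rwa [hBU z hz' (h.subset D hD hz)]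
            exact fun z hz => Or.inl
              ⟨h2 D hD u hu v hv huv (key u hu huT) (key v hv hvT) hz, h.subset D hD hz⟩
        · rintro (h4 | h4)
          · exact h3 h4.1
          · exact h3 (hBU a h4 haU ▸ hcT)
      · refine ⟨insert b (T ∩ U), ?_, ?_, ?_⟩
        · rintro z ⟨rfl | hz, hza⟩
          · exact Or.inl rfl
          · exact Or.inr ⟨h1 ⟨hz, hza⟩, hSU hz⟩
        · rintro D (rfl | hD) u hu v hv huv huT hvT
          · have key : ∀ z ∈ D, z ∈ insert b (T ∩ U) → z = b := by
              rintro z hz (hz' | hz')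
              · exact hz'
              · exact absurd (hBU z hz hz'.2 ▸ hz'.1) hcT
            exact absurd ((key u hu huT).trans (key v hv hvT).symm) huv
          · have key : ∀ z ∈ D, z ∈ insert b (T ∩ U) → z ∈ T := by
              rintro z hz (rfl | hz')
              · exact absurd (h.subset D hD hz) hbU
              · exact hz'.1
            exact fun z hz => Or.inr
              ⟨h2 D hD u hu v hv huv (key u hu huT) (key v hv hvT) hz, h.subset D hD hz⟩
        · rintro (rfl | h4)
          · exact hbU haU
          · exact h3 h4.1

theorem induce_connected_of_walks {G : SimpleGraph V} {S : Set V} {r : V} (hr : r ∈ S)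
    (h : ∀ v ∈ S, ∃ p : G.Walk r v, ∀ z ∈ p.support, z ∈ S) : (G.induce S).Connected := by
  refine (SimpleGraph.connected_iff_exists_forall_reachable _).2 ⟨⟨r, hr⟩, ?_⟩
  rintro ⟨v, hv⟩
  obtain ⟨p, hp⟩ := h v hv
  exact ⟨p.induce S hp⟩

theorem induce_connected_of_adj {G : SimpleGraph V} {S : Set V} {r : V} (hr : r ∈ S)
    (h : ∀ v ∈ S, v ≠ r → G.Adj r v) : (G.induce S).Connected := by
  refine induce_connected_of_walks hr fun v hv => ?_
  by_cases hvr : v = r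
  · subst hvr
    exact ⟨.nil, by simpa using hv⟩
  · exact ⟨(h v hv hvr).toWalk, by simp [hr, hv]⟩

theorem CompleteOn.noCutSet_union [Finite V] {G : SimpleGraph V} {B D : Set V} {p q : V}
    (hB : CompleteOn G B) (hD : CompleteOn G D) (hp : p ∈ B ∩ D) (hq : q ∈ B ∩ D)
    (hpq : p ≠ q) : NoCutSet G (B ∪ D) := by
  have key : ∀ r ∈ B ∩ D, ∀ v ∈ B ∪ D, v ≠ r → G.Adj r v := by
    rintro r ⟨hrB, hrD⟩ v (hv | hv) hvr
    · exact hB r hrB v hv hvr.symm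
    · exact hD r hrD v hv hvr.symm
  refine ⟨?_, induce_connected_of_adj (Or.inl hp.1) (key p hp), fun v _ => ?_⟩
  · rw [← Set.ncard_pair hpq]
    refine Set.ncard_le_ncard ?_
    rintro z (rfl | rfl)
    exacts [Or.inl hp.1, Or.inl hq.1]
  · by_cases hv : v = p
    · subst hv
      exact induce_connected_of_adj ⟨Or.inl hq.1, hpq.symm⟩ fun z hz => key q hq z hz.1
    · exact induce_connected_of_adj ⟨Or.inl hp.1, Ne.symm hv⟩ fun z hz => key p hp z hz.1

theorem CompleteOn.noCutSet [Finite V] {G : SimpleGraph V} {B : Set V} {p q : V}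
    (hB : CompleteOn G B) (hp : p ∈ B) (hq : q ∈ B) (hpq : p ≠ q) : NoCutSet G B := by
  simpa using hB.noCutSet_union hB ⟨hp, hp⟩ ⟨hq, hq⟩ hpq

theorem NoCutSet.exists_isBlock [Finite V] {G : SimpleGraph V} {S : Set V} (h : NoCutSet G S) :
    ∃ B, IsBlock G B ∧ S ⊆ B := by
  obtain ⟨B, hSB, hB⟩ := Finite.exists_le_maximal h
  exact ⟨B, ⟨hB.1, fun B' hB' hle => hB.eq_of_subset hB' hle⟩, hSB⟩

/-- A path closed up by one further vertex has no cut vertex. -/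
theorem noCutSet_insert_support [Finite V] {G : SimpleGraph V} {x c y : V} (p : G.Walk x c)
    (hp : p.IsPath) (hy : y ∉ p.support) (hyx : G.Adj y x) (hyc : G.Adj y c) :
    NoCutSet G (insert y {z | z ∈ p.support}) := by
  classical
  have hxp : x ∈ p.support := p.start_mem_support
  refine ⟨?_, ?_, ?_⟩
  · rw [← Set.ncard_pair hyx.ne]
    refine Set.ncard_le_ncard ?_
    rintro z (rfl | rfl)
    exacts [Or.inl rfl, Or.inr hxp]
  · refine induce_connected_of_walks (Or.inl rfl) fun v hv => ?_
    rcases hv with rfl | hv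
    · exact ⟨.nil, by simp⟩
    · refine ⟨.cons hyx (p.takeUntil v hv), fun z hz => ?_⟩
      rw [SimpleGraph.Walk.support_cons, List.mem_cons] at hz
      exact hz.imp id fun hz => p.support_takeUntil_subset_support hv hz
  · rintro v (rfl | hv)
    · refine induce_connected_of_walks (r := x) ⟨Or.inr hxp, hyx.ne'⟩ ?_
      rintro u ⟨hu | hu, huv⟩
      · exact absurd hu huv
      · refine ⟨p.takeUntil u hu, fun z hz => ?_⟩
        have hz' := p.support_takeUntil_subset_support hu hz
        exact ⟨Or.inr hz', fun e => hy (e ▸ hz')⟩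
    · have hyv : y ≠ v := fun e => hy (e ▸ hv)
      refine induce_connected_of_walks (r := y) ⟨Or.inl rfl, hyv⟩ ?_
      rintro u ⟨rfl | hu, huv⟩
      · exact ⟨.nil, by simpa using huv⟩
      · by_cases hvt : v ∈ (p.takeUntil u hu).support
        · have hvd : v ∉ (p.dropUntil u hu).support := by
            intro hvd
            have hnd := hp.support_nodup
            rw [← p.take_spec hu, SimpleGraph.Walk.support_append] at hnd
            refine List.disjoint_of_nodup_append hnd hvt ?_
            rw [← SimpleGraph.Walk.cons_tail_support] at hvd
            exact (List.mem_cons.1 hvd).resolve_left (Ne.symm huv)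
          refine ⟨.cons hyc (p.dropUntil u hu).reverse, fun z hz => ?_⟩
          rw [SimpleGraph.Walk.support_cons, List.mem_cons,
            SimpleGraph.Walk.support_reverse, List.mem_reverse] at hz
          rcases hz with rfl | hz
          · exact ⟨Or.inl rfl, hyv⟩
          · exact ⟨Or.inr (p.support_dropUntil_subset_support hu hz), fun e => hvd (e ▸ hz)⟩
        · refine ⟨.cons hyx (p.takeUntil u hu), fun z hz => ?_⟩
          rw [SimpleGraph.Walk.support_cons, List.mem_cons] at hz
          rcases hz with rfl | hz
          · exact ⟨Or.inl rfl, hyv⟩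
          · exact ⟨Or.inr (p.support_takeUntil_subset_support hu hz), fun e => hvt (e ▸ hz)⟩

theorem noCutSet_of_connected [Finite V] {G : SimpleGraph V} {U : Set V}
    (hU : (G.induce U).Connected) {x c y : V} (hx : x ∈ U) (hc : c ∈ U) (hy : y ∉ U)
    (hyx : G.Adj y x) (hyc : G.Adj y c) :
    ∃ Z, NoCutSet G Z ∧ x ∈ Z ∧ c ∈ Z ∧ y ∈ Z := by
  obtain ⟨p, hp⟩ := hU.exists_isPath ⟨x, hx⟩ ⟨c, hc⟩
  have hpU : ∀ z ∈ (p.map (SimpleGraph.Embedding.induce U).toHom).support, z ∈ U := by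
    intro z hz
    rw [SimpleGraph.Walk.support_map, List.mem_map] at hz
    obtain ⟨w, -, rfl⟩ := hz
    exact w.2
  exact ⟨_, noCutSet_insert_support (p.map (SimpleGraph.Embedding.induce U).toHom)
    (hp.map Subtype.val_injective)
    (fun h => hy (hpU y h)) hyx hyc, Or.inr (SimpleGraph.Walk.start_mem_support _),
    Or.inr (SimpleGraph.Walk.end_mem_support _), Or.inl rfl⟩

theorem IsBlock.eq_of_mem [Finite V] {G : SimpleGraph V}
    (hbg : ∀ B : Set V, IsBlock G B → CompleteOn G B) {B D : Set V} (hB : IsBlock G B)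
    (hD : IsBlock G D) {p q : V} (hp : p ∈ B ∩ D) (hq : q ∈ B ∩ D) (hpq : p ≠ q) : B = D := by
  have h := (hbg B hB).noCutSet_union (hbg D hD) hp hq hpq
  exact (hB.2 _ h Set.subset_union_left).trans (hD.2 _ h Set.subset_union_right).symm

theorem exists_isBlock_of_adj [Finite V] {G : SimpleGraph V} {u v : V} (h : G.Adj u v) :
    ∃ B, IsBlock G B ∧ u ∈ B ∧ v ∈ B := by
  have hc : CompleteOn G {u, v} := by
    rintro x (rfl | rfl) y (rfl | rfl) hxy
    exacts [absurd rfl hxy, h, h.symm, absurd rfl hxy]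
  obtain ⟨B, hB, hle⟩ := (hc.noCutSet (Or.inl rfl) (Or.inr rfl) h.ne).exists_isBlock
  exact ⟨B, hB, hle (Or.inl rfl), hle (Or.inr rfl)⟩

theorem lineClosed_isBlock_iff [Finite V] {G : SimpleGraph V}
    (hbg : ∀ B : Set V, IsBlock G B → CompleteOn G B) (T : Set V) :
    LineClosed {B | IsBlock G B} T ↔ DeltaConvex G T := by
  constructor
  · intro h u v w hu hv huv hwu hwv
    have hc : CompleteOn G {u, v, w} := by
      rintro x (rfl | rfl | rfl) y (rfl | rfl | rfl) hxy <;>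
        first | exact absurd rfl hxy | assumption | (apply SimpleGraph.Adj.symm; assumption)
    obtain ⟨B, hB, hle⟩ := (hc.noCutSet (p := u) (q := v) (by simp) (by simp)
      huv.ne).exists_isBlock
    exact h B hB u (hle (by simp)) v (hle (by simp)) huv.ne hu hv (hle (by simp))
  · intro h B hB u hu v hv huv huT hvT w hw
    by_cases hwu : w = u
    · exact hwu ▸ huT
    by_cases hwv : w = v
    · exact hwv ▸ hvT
    exact h huT hvT (hbg B hB u hu v hv huv) (hbg B hB w hw u hu hwu) (hbg B hB w hw v hv hwv)

theorem convIndep_iff_lineIndep [Finite V] {G : SimpleGraph V}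
    (hbg : ∀ B : Set V, IsBlock G B → CompleteOn G B) (S : Set V) :
    ConvIndep G S ↔ LineIndep {B | IsBlock G B} S := by
  simp only [ConvIndep, LineIndep, deltaHull, lineClosed_isBlock_iff hbg, Set.mem_sInter,
    Set.mem_ofPred_eq, not_forall, exists_prop, and_assoc]

theorem hypertree_isBlock_of_partial [Finite V] {G : SimpleGraph V} (hconn : G.Connected)
    (hbg : ∀ B : Set V, IsBlock G B → CompleteOn G B) {L : Set (Set V)} {U : Set V}
    (hT : Hypertree L U) (hL : ∀ B ∈ L, IsBlock G B) (hU : (G.induce U).Connected)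
    (hE : ∀ x ∈ U, ∀ y ∈ U, G.Adj x y → ∃ B ∈ L, x ∈ B ∧ y ∈ B) :
    Hypertree {B | IsBlock G B} Set.univ := by
  induction hn : Uᶜ.ncard using Nat.strong_induction_on generalizing L U with
  | _ n ih =>
  obtain ⟨⟨r, hr⟩⟩ := hU.nonempty
  by_cases hUu : U = Set.univ
  · subst hUu
    suffices L = {B | IsBlock G B} from this ▸ hT
    refine Set.Subset.antisymm hL fun D hD => ?_
    obtain ⟨p, hp, q, hq, hpq⟩ := (Set.one_lt_ncard (Set.toFinite D)).1 hD.1.1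
    obtain ⟨B, hB, hpB, hqB⟩ := hE p trivial q trivial (hbg D hD p hp q hq hpq)
    rwa [IsBlock.eq_of_mem hbg hD (hL B hB) ⟨hp, hpB⟩ ⟨hq, hqB⟩ hpq]
  · obtain ⟨t, ht⟩ := (Set.ne_univ_iff_exists_notMem U).1 hUu
    obtain ⟨w⟩ := hconn.preconnected r t
    obtain ⟨⟨⟨c, b⟩, hcb⟩, -, hc, hb⟩ := w.exists_boundary_dart U hr ht
    simp only at hc hb hcb
    obtain ⟨B, hB, hcB, hbB⟩ := exists_isBlock_of_adj hcb
    have hBU : ∀ z ∈ B, z ∈ U → z = c := by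
      intro d hd hdU
      by_contra hdc
      obtain ⟨D, hD, hdD, hcD⟩ := hE d hdU c hc (hbg B hB d hd c hcB hdc)
      have := IsBlock.eq_of_mem hbg hB (hL D hD) ⟨hd, hdD⟩ ⟨hcB, hcD⟩ hdc
      exact hb (hT.subset D hD (this ▸ hbB))
    have hint : B ∩ U = {c} :=
      Set.Subset.antisymm (fun z hz => hBU z hz.1 hz.2) (Set.singleton_subset_iff.2 ⟨hcB, hc⟩)
    have hcross : ∀ x ∈ U, ∀ y ∈ B, G.Adj x y → y ∉ U → x ∈ B := by
      intro x hx y hy hxy hyU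
      obtain ⟨Z, hZ, hxZ, hcZ, hyZ⟩ := noCutSet_of_connected hU hx hc hyU hxy.symm
        (hbg B hB y hy c hcB fun e => hyU (e ▸ hc))
      obtain ⟨D, hD, hZD⟩ := hZ.exists_isBlock
      rw [IsBlock.eq_of_mem hbg hB hD ⟨hy, hZD hyZ⟩ ⟨hcB, hZD hcZ⟩ fun e => hyU (e ▸ hc)]
      exact hZD hxZ
    refine ih _ ?_ (hT.attach hint hbB hb) ?_ ?_ ?_ rfl
    · rw [← hn]
      refine Set.ncard_lt_ncard ?_
      refine ⟨Set.compl_subset_compl.2 Set.subset_union_left, fun h => ?_⟩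
      exact h hb (Or.inr hbB)
    · rintro D (rfl | hD)
      exacts [hB, hL D hD]
    · exact SimpleGraph.induce_union_connected hU.preconnected hB.1.2.1.preconnected ⟨c, hc, hcB⟩
    · intro x hx y hy hxy
      by_cases hxU : x ∈ U
      · by_cases hyU : y ∈ U
        · obtain ⟨D, hD, h⟩ := hE x hxU y hyU hxy
          exact ⟨D, Or.inr hD, h⟩
        · have hyB := hy.resolve_left hyU
          exact ⟨B, Or.inl rfl, hcross x hxU y hyB hxy hyU, hyB⟩
      · have hxB := hx.resolve_left hxU
        by_cases hyU : y ∈ U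
        · exact ⟨B, Or.inl rfl, hxB, hcross y hyU x hxB hxy.symm hxU⟩
        · exact ⟨B, Or.inl rfl, hxB, hy.resolve_left hyU⟩

/-- The blocks of a finite connected block graph form a hypertree. -/
theorem hypertree_isBlock [Finite V] {G : SimpleGraph V} (hconn : G.Connected)
    (hbg : ∀ B : Set V, IsBlock G B → CompleteOn G B) :
    Hypertree {B | IsBlock G B} Set.univ := by
  obtain ⟨r⟩ := hconn.nonempty
  refine hypertree_isBlock_of_partial hconn hbg (.singleton r) (by simp)
    (induce_connected_of_adj rfl fun v hv hvr => absurd hv hvr) ?_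
  rintro x rfl y rfl h
  exact absurd h (G.loopless.irrefl _)

/-- If `G` is a finite simple connected block graph (every block complete)
with exactly `ℓ` blocks, then the rank satisfies `d_Δ(G) = ℓ + 1`. -/
theorem stmt_19 {V : Type*} [Fintype V] (G : SimpleGraph V) (hconn : G.Connected)
    (hbg : ∀ B : Set V, IsBlock G B → CompleteOn G B)
    (ℓ : ℕ) (hℓ : {B : Set V | IsBlock G B}.ncard = ℓ) :
    rankDelta G = ℓ + 1 := by
  have hT := hypertree_isBlock hconn hbg
  refine IsGreatest.csSup_eq ⟨?_, ?_⟩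
  · obtain ⟨S, -, hS, hcard⟩ := hT.exists_lineIndep
    exact ⟨S, (convIndep_iff_lineIndep hbg S).2 hS, hcard.trans (by rw [hℓ])⟩
  · rintro n ⟨S, hS, rfl⟩
    rw [← hℓ]
    exact hT.ncard_le S (Set.subset_univ S) ((convIndep_iff_lineIndep hbg S).1 hS)
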